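/- arXiv:1312.1678 — 2 statements merged into one kernel-verified Lean document; each statement's English description precedes it below -/
import Mathlib

section
/- Let c > 0 be a real number and let F be a finite family of n distinct closed discs in ℝ² in general position such that every subfamily F' ⊆ F has union complexity at most c·|F'|. Let ω ≥ 2 be an integer such that every subfamily of F whose members pairwise intersect has size at most ω. Then the set Z of all points of ℝ² lying on at least two boundary circles of discs of F satisfies |Z| ≤ c·e·ω·n. -/
open scoped Classical

/-- The probability that a `p`-random subset of `F` equals `S`. -/
noncomputable def sampleWeight {α : Type*} (F : Finset α) (p : ℝ) (S : Finset α) : ℝ :=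
  p ^ S.card * (1 - p) ^ (F \ S).card

theorem sampleWeight_nonneg {α : Type*} (F : Finset α) {p : ℝ} (hp0 : 0 ≤ p) (hp1 : p ≤ 1)
    (S : Finset α) : 0 ≤ sampleWeight F p S :=
  mul_nonneg (pow_nonneg hp0 _) (pow_nonneg (sub_nonneg.2 hp1) _)

/-- The probability that a `p`-random subset of `F` contains `A` and avoids `B`. -/
theorem sum_sampleWeight_filter {α : Type*} (F A B : Finset α) (p : ℝ) (hA : A ⊆ F)
    (hB : B ⊆ F) (hAB : Disjoint A B) :
    ∑ S ∈ F.powerset with A ⊆ S ∧ Disjoint S B, sampleWeight F p S =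
      p ^ A.card * (1 - p) ^ B.card := by
  have h := Finset.prod_add (fun i => if i ∈ B then 0 else p)
    (fun i => if i ∈ A then 0 else 1 - p) F
  have hl : ∏ i ∈ F, ((if i ∈ B then 0 else p) + (if i ∈ A then 0 else 1 - p)) =
      p ^ A.card * (1 - p) ^ B.card := by
    have : ∀ i ∈ F, ((if i ∈ B then 0 else p) + (if i ∈ A then 0 else 1 - p)) =
        (if i ∈ A then p else 1) * (if i ∈ B then 1 - p else 1) := by
      intro i _
      have hi : i ∈ A → i ∉ B := fun hiA => Finset.disjoint_left.1 hAB hiA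
      by_cases h1 : i ∈ A <;> by_cases h2 : i ∈ B <;> simp_all
    rw [Finset.prod_congr rfl this, Finset.prod_mul_distrib, Finset.prod_ite_mem,
      Finset.prod_ite_mem, Finset.inter_eq_right.2 hA, Finset.inter_eq_right.2 hB,
      Finset.prod_const, Finset.prod_const]
  rw [← hl, h, Finset.sum_filter]
  refine Finset.sum_congr rfl fun S hS => ?_
  split_ifs with hc
  · rw [sampleWeight]
    congr 1
    · rw [← Finset.prod_const]
      refine Finset.prod_congr rfl fun i hi => ?_
      rw [if_neg (Finset.disjoint_left.1 hc.2 hi)]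
    · rw [← Finset.prod_const]
      refine Finset.prod_congr rfl fun i hi => ?_
      rw [if_neg fun hiA => (Finset.mem_sdiff.1 hi).2 (hc.1 hiA)]
  · symm
    rw [mul_eq_zero]
    by_contra! hne
    refine hc ⟨fun i hi => ?_, Finset.disjoint_left.2 fun i hi hiB => ?_⟩
    · by_contra hiS
      exact hne.2 (Finset.prod_eq_zero (Finset.mem_sdiff.2 ⟨hA hi, hiS⟩) (if_pos hi))
    · exact hne.1 (Finset.prod_eq_zero hi (if_pos hiB))

/-- The expected size of a `p`-random subset. -/
theorem sum_sampleWeight_mul_card {α : Type*} (F : Finset α) (p : ℝ) :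
    ∑ S ∈ F.powerset, sampleWeight F p S * S.card = p * F.card := by
  have h : ∀ S ∈ F.powerset, sampleWeight F p S * S.card =
      ∑ d ∈ F, if d ∈ S then sampleWeight F p S else 0 := by
    intro S hS
    rw [← Finset.sum_filter, Finset.filter_mem_eq_inter,
      Finset.inter_eq_right.2 (Finset.mem_powerset.1 hS), Finset.sum_const, nsmul_eq_mul,
      mul_comm]
  rw [Finset.sum_congr rfl h, Finset.sum_comm]
  have h2 : ∀ d ∈ F, (∑ S ∈ F.powerset, if d ∈ S then sampleWeight F p S else 0) = p := by
    intro d hd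
    have := sum_sampleWeight_filter F {d} ∅ p (by simpa using hd) (by simp) (by simp)
    simpa [Finset.sum_filter] using this
  rw [Finset.sum_congr rfl h2, Finset.sum_const, nsmul_eq_mul, mul_comm]

/-- Any two vectors of the plane make a non-obtuse angle with a common nonzero vector. -/
theorem exists_ne_zero_inner_nonneg (v w : EuclideanSpace ℝ (Fin 2)) :
    ∃ u : EuclideanSpace ℝ (Fin 2), u ≠ 0 ∧ 0 ≤ inner ℝ v u ∧ 0 ≤ inner ℝ w u := by
  by_cases hv : v = 0
  · by_cases hw : w = 0
    · exact ⟨EuclideanSpace.single 0 1, by simp, by simp [hv], by simp [hw]⟩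
    · exact ⟨w, hw, by simp [hv], real_inner_self_nonneg⟩
  · have hn : ∃ u : EuclideanSpace ℝ (Fin 2), u ≠ 0 ∧ inner ℝ v u = 0 := by
      refine ⟨!₂[-v 1, v 0], fun h => hv ?_, ?_⟩
      · have h0 := congrArg (fun x : EuclideanSpace ℝ (Fin 2) => x 0) h
        have h1 := congrArg (fun x : EuclideanSpace ℝ (Fin 2) => x 1) h
        ext i
        fin_cases i <;> simp_all
      · simp [PiLp.inner_apply, Fin.sum_univ_two]
        ring
    obtain ⟨u, hu, huv⟩ := hn
    rcases le_total 0 (inner ℝ w u) with h | h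
    · exact ⟨u, hu, huv.ge, h⟩
    · exact ⟨-u, by simpa using hu, by simp [huv], by simpa using h⟩

theorem add_smul_notMem_closedBall {E : Type*} [NormedAddCommGroup E] [InnerProductSpace ℝ E]
    {a z u : E} {r t : ℝ} (hz : z ∈ Metric.sphere a r) (hu : u ≠ 0)
    (hau : 0 ≤ inner ℝ (z - a) u) (ht : 0 < t) : z + t • u ∉ Metric.closedBall a r := by
  rw [Metric.mem_closedBall, dist_eq_norm, not_le]
  rw [mem_sphere_iff_norm] at hz
  have h : z + t • u - a = (z - a) + t • u := by abel
  have h2 := norm_add_sq_real (z - a) (t • u)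
  rw [inner_smul_right, norm_smul, Real.norm_of_nonneg ht.le, hz] at h2
  rw [h]
  refine lt_of_pow_lt_pow_left₀ 2 (norm_nonneg _) ?_
  have : 0 < t * ‖u‖ := mul_pos ht (norm_pos_iff.2 hu)
  nlinarith [mul_nonneg ht.le hau]

/-- A point on at most two of the circles, outside all the other discs, is on the frontier of the
union of the discs. -/
theorem mem_frontier_iUnion_closedBall {S : Finset (EuclideanSpace ℝ (Fin 2) × ℝ)}
    {z : EuclideanSpace ℝ (Fin 2)} {d d' : EuclideanSpace ℝ (Fin 2) × ℝ} (hd : d ∈ S)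
    (hz : z ∈ Metric.sphere d.1 d.2) (hz' : z ∈ Metric.sphere d'.1 d'.2)
    (hS : ∀ x ∈ S, x ≠ d → x ≠ d' → z ∉ Metric.closedBall x.1 x.2) :
    z ∈ frontier (⋃ x ∈ (S : Set (EuclideanSpace ℝ (Fin 2) × ℝ)),
      Metric.closedBall x.1 x.2) := by
  refine ⟨subset_closure (Set.mem_biUnion hd (Metric.sphere_subset_closedBall hz)), fun hint => ?_⟩
  obtain ⟨u, hu, h1, h2⟩ := exists_ne_zero_inner_nonneg (z - d.1) (z - d'.1)
  have hcont : Filter.Tendsto (fun t : ℝ => z + t • u) (nhdsWithin 0 (Set.Ioi 0)) (nhds z) := by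
    have : Continuous fun t : ℝ => z + t • u := by fun_prop
    simpa using (this.tendsto 0).mono_left nhdsWithin_le_nhds
  have hout : ∀ᶠ y in nhds z, ∀ x ∈ S, x ≠ d → x ≠ d' → y ∉ Metric.closedBall x.1 x.2 := by
    rw [Filter.eventually_all_finset]
    intro x hx
    by_cases hc : x ≠ d ∧ x ≠ d'
    · filter_upwards [Metric.isClosed_closedBall.isOpen_compl.mem_nhds (hS x hx hc.1 hc.2)]
        with y hy _ _ using hy
    · exact Filter.Eventually.of_forall fun y ha hb => absurd ⟨ha, hb⟩ hc
  have hnear : ∀ᶠ y in nhds z, y ∈ ⋃ x ∈ (S : Set (EuclideanSpace ℝ (Fin 2) × ℝ)),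
      Metric.closedBall x.1 x.2 := mem_interior_iff_mem_nhds.1 hint
  obtain ⟨t, ⟨hin, hnot⟩, ht⟩ := ((hcont.eventually (hnear.and hout)).and self_mem_nhdsWithin).exists
  obtain ⟨x, hx, hxt⟩ := Set.mem_iUnion₂.1 hin
  by_cases hxd : x = d
  · exact add_smul_notMem_closedBall hz hu h1 ht (hxd ▸ hxt)
  by_cases hxd' : x = d'
  · exact add_smul_notMem_closedBall hz' hu h2 ht (hxd' ▸ hxt)
  exact hnot x hx hxd hxd' hxt

theorem exp_neg_one_le_one_sub_inv_pow {ω : ℕ} (hω : 2 ≤ ω) :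
    Real.exp (-1) ≤ (1 - (ω : ℝ)⁻¹) ^ (ω - 2) := by
  obtain ⟨k, rfl⟩ := Nat.exists_eq_add_of_le' hω
  have hk : (0 : ℝ) < k + 1 := by positivity
  have h : Real.exp (-(1 / (k + 1))) ≤ 1 - ((k + 2 : ℕ) : ℝ)⁻¹ := by
    have h1 := Real.add_one_le_exp (1 / ((k : ℝ) + 1))
    rw [Real.exp_neg]
    have h2 : 1 - ((k + 2 : ℕ) : ℝ)⁻¹ = (1 / ((k : ℝ) + 1) + 1)⁻¹ := by
      push_cast
      field_simp
      ring
    rw [h2]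
    exact inv_anti₀ (by positivity) h1
  rw [Nat.add_sub_cancel]
  refine le_trans ?_ (pow_le_pow_left₀ (Real.exp_nonneg _) h k)
  rw [← Real.exp_nat_mul]
  refine Real.exp_le_exp.2 ?_
  have : (k : ℝ) * (1 / (k + 1)) ≤ 1 := by
    rw [mul_one_div, div_le_one hk]
    linarith
  linarith

/-- **Key intermediate bound in the proof of Theorem 1, for closed discs.**
A disc is given by a pair `d = (center, radius)` in `EuclideanSpace ℝ (Fin 2) × ℝ`,
with the disc itself being `Metric.closedBall d.1 d.2` and its boundary circle
`Metric.sphere d.1 d.2`.  If every subfamily `F' ⊆ F` has union complexity at most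
`c·|F'|` and every pairwise-intersecting subfamily has size at most `ω`, then the set
`Z` of points lying on at least two boundary circles satisfies `|Z| ≤ c·e·ω·n`. -/
theorem stmt_1 (c : ℝ) (hc : 0 < c)
    (F : Finset (EuclideanSpace ℝ (Fin 2) × ℝ))
    (hrad : ∀ d ∈ F, 0 < d.2)
    (hgen2 : ∀ d ∈ F, ∀ d' ∈ F, d ≠ d' →
      (Metric.sphere d.1 d.2 ∩ Metric.sphere d'.1 d'.2).encard = 0 ∨
      (Metric.sphere d.1 d.2 ∩ Metric.sphere d'.1 d'.2).encard = 2)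
    (hgen3 : ∀ x : EuclideanSpace ℝ (Fin 2),
      ({d ∈ F | x ∈ Metric.sphere d.1 d.2}).card ≤ 2)
    (huc : ∀ F' ⊆ F,
      {x : EuclideanSpace ℝ (Fin 2) |
        x ∈ frontier (⋃ d ∈ (F' : Set (EuclideanSpace ℝ (Fin 2) × ℝ)),
          Metric.closedBall d.1 d.2) ∧
        2 ≤ ({d ∈ F' | x ∈ Metric.sphere d.1 d.2}).card}.Finite ∧
      ({x : EuclideanSpace ℝ (Fin 2) |
        x ∈ frontier (⋃ d ∈ (F' : Set (EuclideanSpace ℝ (Fin 2) × ℝ)),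
          Metric.closedBall d.1 d.2) ∧
        2 ≤ ({d ∈ F' | x ∈ Metric.sphere d.1 d.2}).card}.ncard : ℝ) ≤ c * F'.card)
    (ω : ℕ) (hω : 2 ≤ ω)
    (hclique : ∀ G ⊆ F, (∀ d ∈ G, ∀ d' ∈ G,
      (Metric.closedBall d.1 d.2 ∩ Metric.closedBall d'.1 d'.2).Nonempty) → G.card ≤ ω) :
    {x : EuclideanSpace ℝ (Fin 2) |
      2 ≤ ({d ∈ F | x ∈ Metric.sphere d.1 d.2}).card}.Finite ∧
    ({x : EuclideanSpace ℝ (Fin 2) |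
      2 ≤ ({d ∈ F | x ∈ Metric.sphere d.1 d.2}).card}.ncard : ℝ) ≤
      c * Real.exp 1 * ω * F.card := by
  set V : Finset (EuclideanSpace ℝ (Fin 2) × ℝ) → Set (EuclideanSpace ℝ (Fin 2)) := fun F' =>
    {x | x ∈ frontier (⋃ d ∈ (F' : Set (EuclideanSpace ℝ (Fin 2) × ℝ)),
          Metric.closedBall d.1 d.2) ∧
        2 ≤ ({d ∈ F' | x ∈ Metric.sphere d.1 d.2}).card}
  set Z : Set (EuclideanSpace ℝ (Fin 2)) :=
    {x | 2 ≤ ({d ∈ F | x ∈ Metric.sphere d.1 d.2}).card}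
  set A : EuclideanSpace ℝ (Fin 2) → Finset (EuclideanSpace ℝ (Fin 2) × ℝ) := fun x =>
    {d ∈ F | x ∈ Metric.sphere d.1 d.2}
  set B : EuclideanSpace ℝ (Fin 2) → Finset (EuclideanSpace ℝ (Fin 2) × ℝ) := fun x =>
    {d ∈ F | x ∈ Metric.ball d.1 d.2}
  have hAF : ∀ z, A z ⊆ F := fun z => Finset.filter_subset _ _
  have hBF : ∀ z, B z ⊆ F := fun z => Finset.filter_subset _ _
  have hAB : ∀ z, Disjoint (A z) (B z) := fun z => Finset.disjoint_filter.2 fun d _ h1 h2 => by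
    rw [Metric.mem_sphere] at h1
    rw [Metric.mem_ball] at h2
    exact h2.ne h1
  have hA2 : ∀ z ∈ Z, (A z).card = 2 := fun z hz => le_antisymm (hgen3 z) hz
  have hmem : ∀ z ∈ Z, ∀ S ⊆ F, A z ⊆ S → Disjoint S (B z) → z ∈ V S := by
    intro z hz S hSF hAS hSB
    obtain ⟨d, d', -, hdd⟩ := Finset.card_eq_two.1 (hA2 z hz)
    have hd : d ∈ A z := by simp [hdd]
    have hd' : d' ∈ A z := by simp [hdd]
    refine ⟨mem_frontier_iUnion_closedBall (hAS hd) (Finset.mem_filter.1 hd).2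
      (Finset.mem_filter.1 hd').2 fun x hx hxd hxd' hxz => ?_, ?_⟩
    · rcases (Metric.mem_closedBall.1 hxz).lt_or_eq with h | h
      · exact Finset.disjoint_left.1 hSB hx (Finset.mem_filter.2 ⟨hSF hx, h⟩)
      · have : x ∈ A z := Finset.mem_filter.2 ⟨hSF hx, h⟩
        simp [hdd, hxd, hxd'] at this
    · refine (hA2 z hz).ge.trans ?_
      exact Finset.card_le_card fun x hx => Finset.mem_filter.2
        ⟨hAS hx, (Finset.mem_filter.1 hx).2⟩
  have hZfin : Z.Finite := by
    refine (F.powerset.finite_toSet.biUnion fun S hS =>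
      (huc S (Finset.mem_powerset.1 hS)).1).subset fun z hz => ?_
    exact Set.mem_biUnion (Finset.mem_coe.2 (Finset.mem_powerset.2 (hAF z)))
      (hmem z hz _ (hAF z) subset_rfl (hAB z))
  refine ⟨hZfin, ?_⟩
  have hω0 : (0 : ℝ) < ω := by positivity
  set p : ℝ := (ω : ℝ)⁻¹
  have hp0 : 0 < p := by positivity
  have hp1 : p ≤ 1 := inv_le_one_of_one_le₀ (by exact_mod_cast (by omega : 1 ≤ ω))
  have hBcard : ∀ z ∈ Z, (B z).card ≤ ω - 2 := by
    intro z hz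
    have h : ∀ d ∈ A z ∪ B z, z ∈ Metric.closedBall d.1 d.2 := by
      intro d hd
      rcases Finset.mem_union.1 hd with h | h
      · exact Metric.sphere_subset_closedBall (Finset.mem_filter.1 h).2
      · exact Metric.ball_subset_closedBall (Finset.mem_filter.1 h).2
    have h1 := hclique (A z ∪ B z) (Finset.union_subset (hAF z) (hBF z))
      fun d hd d' hd' => ⟨z, h d hd, h d' hd'⟩
    rw [Finset.card_union_of_disjoint (hAB z), hA2 z hz] at h1
    omega
  have hlow : ∀ z ∈ Z, p ^ 2 * Real.exp (-1) ≤
      ∑ S ∈ F.powerset, if z ∈ V S then sampleWeight F p S else 0 := by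
    intro z hz
    calc p ^ 2 * Real.exp (-1) ≤ p ^ 2 * (1 - p) ^ (ω - 2) := by
          gcongr
          exact exp_neg_one_le_one_sub_inv_pow hω
      _ ≤ p ^ 2 * (1 - p) ^ (B z).card := by
          refine mul_le_mul_of_nonneg_left ?_ (by positivity)
          exact pow_le_pow_of_le_one (by linarith) (by linarith) (hBcard z hz)
      _ = ∑ S ∈ F.powerset with A z ⊆ S ∧ Disjoint S (B z), sampleWeight F p S := by
          have h := sum_sampleWeight_filter F _ _ p (hAF z) (hBF z) (hAB z)
          rw [hA2 z hz] at h
          rw [← h]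
          exact Finset.sum_congr (by ext; simp only [Finset.mem_filter]) fun _ _ => rfl
      _ ≤ ∑ S ∈ F.powerset with z ∈ V S, sampleWeight F p S := by
          refine Finset.sum_le_sum_of_subset_of_nonneg (fun S hS => ?_)
            fun S _ _ => sampleWeight_nonneg F hp0.le hp1 S
          obtain ⟨h1, h2, h3⟩ := Finset.mem_filter.1 hS
          exact Finset.mem_filter.2 ⟨h1, hmem z hz S (Finset.mem_powerset.1 h1) h2 h3⟩
      _ = _ := Finset.sum_filter _ _
  have hup : ∀ S ∈ F.powerset,
      (∑ z ∈ hZfin.toFinset, if z ∈ V S then sampleWeight F p S else 0) ≤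
        c * (sampleWeight F p S * S.card) := by
    intro S hS
    obtain ⟨hfin, hle⟩ := huc S (Finset.mem_powerset.1 hS)
    have hcard : (hZfin.toFinset.filter (· ∈ V S)).card ≤ (V S).ncard := by
      rw [← Set.ncard_coe_finset]
      refine Set.ncard_le_ncard (fun z hz => ?_) hfin
      exact (Finset.mem_filter.1 (Finset.mem_coe.1 hz)).2
    rw [← Finset.sum_filter, Finset.sum_const, nsmul_eq_mul]
    have : ((hZfin.toFinset.filter (· ∈ V S)).card : ℝ) ≤ c * S.card :=
      le_trans (by exact_mod_cast hcard) hle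
    calc _ ≤ c * S.card * sampleWeight F p S :=
          mul_le_mul_of_nonneg_right this (sampleWeight_nonneg F hp0.le hp1 S)
      _ = _ := by ring
  have hmain : (Z.ncard : ℝ) * (p ^ 2 * Real.exp (-1)) ≤ c * (p * F.card) := by
    calc (Z.ncard : ℝ) * (p ^ 2 * Real.exp (-1))
        = ∑ z ∈ hZfin.toFinset, p ^ 2 * Real.exp (-1) := by
          rw [Finset.sum_const, nsmul_eq_mul, Set.ncard_eq_toFinset_card Z hZfin]
      _ ≤ ∑ z ∈ hZfin.toFinset, ∑ S ∈ F.powerset, if z ∈ V S then sampleWeight F p S else 0 :=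
          Finset.sum_le_sum fun z hz => hlow z (hZfin.mem_toFinset.1 hz)
      _ = ∑ S ∈ F.powerset, ∑ z ∈ hZfin.toFinset, if z ∈ V S then sampleWeight F p S else 0 :=
          Finset.sum_comm
      _ ≤ ∑ S ∈ F.powerset, c * (sampleWeight F p S * S.card) := Finset.sum_le_sum hup
      _ = c * (p * F.card) := by rw [← Finset.mul_sum, sum_sampleWeight_mul_card]
  have hpω : p * ω = 1 := inv_mul_cancel₀ hω0.ne'
  have hee : Real.exp (-1) * Real.exp 1 = 1 := by rw [← Real.exp_add]; simp
  have h := mul_le_mul_of_nonneg_right hmain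
    (by positivity : (0 : ℝ) ≤ Real.exp 1 * (ω : ℝ) ^ 2)
  calc (Z.ncard : ℝ)
      = (Z.ncard : ℝ) * (p ^ 2 * Real.exp (-1)) * (Real.exp 1 * (ω : ℝ) ^ 2) := by
        linear_combination (-(Z.ncard : ℝ)) * hee -
          (Z.ncard : ℝ) * (Real.exp (-1) * Real.exp 1) * (p * ω + 1) * hpω
    _ ≤ c * (p * F.card) * (Real.exp 1 * (ω : ℝ) ^ 2) := h
    _ = c * Real.exp 1 * ω * F.card := by
        linear_combination (c * F.card * Real.exp 1 * ω) * hpω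
end

section
/- Let F be a finite set of size n, let ω ≥ 2 be an integer and c > 0 a real number. Let Z be a finite set equipped with maps a, b : Z → F and D : Z → Finset F such that for every z ∈ Z: a z ≠ b z, a z ∉ D z, b z ∉ D z, and |D z| ≤ ω − 2. Suppose that for every subset F' ⊆ F, the number of z ∈ Z with a z ∈ F', b z ∈ F', and D z ∩ F' = ∅ is at most c·|F'|. Then |Z| ≤ c·e·ω·n. -/
open scoped Classical

/-- In a random subset of `F` containing each element independently with probability `p`, the
event of containing `A` and avoiding `D` has probability `p ^ #A * (1 - p) ^ #D`. -/
theorem sum_powerset_subset_disjoint {α : Type*} (F A D : Finset α) (hA : A ⊆ F) (hD : D ⊆ F)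
    (hAD : Disjoint A D) (p : ℝ) :
    ∑ S ∈ F.powerset, (if A ⊆ S ∧ Disjoint D S then
      p ^ S.card * (1 - p) ^ (F \ S).card else 0) = p ^ A.card * (1 - p) ^ D.card := by
  have h := Finset.prod_add (fun i ↦ if i ∈ D then 0 else p)
    (fun i ↦ if i ∈ A then 0 else 1 - p) F
  have hl : ∏ i ∈ F, ((if i ∈ D then 0 else p) + (if i ∈ A then 0 else 1 - p)) =
      p ^ A.card * (1 - p) ^ D.card := by
    calc _ = ∏ i ∈ F, ((if i ∈ A then p else 1) * (if i ∈ D then 1 - p else 1)) := by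
          refine Finset.prod_congr rfl fun i _ ↦ ?_
          by_cases h1 : i ∈ A
          · have h2 : i ∉ D := Finset.disjoint_left.mp hAD h1
            simp [h1, h2]
          · by_cases h2 : i ∈ D <;> simp [h1, h2]
      _ = _ := by
          rw [Finset.prod_mul_distrib, Finset.prod_ite_mem, Finset.prod_ite_mem,
            Finset.inter_eq_right.mpr hA, Finset.inter_eq_right.mpr hD]
          simp
  rw [← hl, h]
  refine Finset.sum_congr rfl fun S _ ↦ ?_
  split_ifs with hS
  · congr 1
    · rw [Finset.prod_congr rfl fun i hi ↦ if_neg (Finset.disjoint_right.mp hS.2 hi)]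
      simp
    · rw [Finset.prod_congr rfl fun i hi ↦
        if_neg fun hiA ↦ (Finset.mem_sdiff.mp hi).2 (hS.1 hiA)]
      simp
  · symm
    by_cases hAS : A ⊆ S
    · obtain ⟨i, hiD, hiS⟩ := Finset.not_disjoint_iff.mp fun hDS ↦ hS ⟨hAS, hDS⟩
      rw [Finset.prod_eq_zero hiS (by simp [hiD]), zero_mul]
    · obtain ⟨i, hiA, hiS⟩ := Finset.not_subset.mp hAS
      exact mul_eq_zero_of_right _
        (Finset.prod_eq_zero (Finset.mem_sdiff.mpr ⟨hA hiA, hiS⟩) (if_pos hiA))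

/-- The expected size of a random subset of `F` containing each element independently with
probability `p` is `#F * p`. -/
theorem sum_powerset_weight_mul_card {α : Type*} (F : Finset α) (p : ℝ) :
    ∑ S ∈ F.powerset, p ^ S.card * (1 - p) ^ (F \ S).card * S.card = F.card * p := by
  calc _ = ∑ S ∈ F.powerset, ∑ i ∈ F, (if {i} ⊆ S ∧ Disjoint ∅ S then
        p ^ S.card * (1 - p) ^ (F \ S).card else 0) := by
        refine Finset.sum_congr rfl fun S hS ↦ ?_
        simp only [Finset.singleton_subset_iff, Finset.disjoint_empty_left, and_true]
        rw [Finset.sum_ite_mem, Finset.inter_eq_right.mpr (Finset.mem_powerset.mp hS)]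
        simp [mul_comm]
    _ = ∑ i ∈ F, p := by
        rw [Finset.sum_comm]
        refine Finset.sum_congr rfl fun i hi ↦ ?_
        rw [sum_powerset_subset_disjoint F {i} ∅ (by simpa using hi) (by simp) (by simp) p]
        simp
    _ = _ := by simp

theorem one_le_exp_one_mul_one_sub_inv_pow (k : ℕ) :
    1 ≤ Real.exp 1 * (1 - 1 / ((k : ℝ) + 2)) ^ k := by
  have hk : (0 : ℝ) ≤ k := k.cast_nonneg
  have h0 : 0 ≤ 1 - 1 / ((k : ℝ) + 2) := by
    rw [sub_nonneg, div_le_one (by linarith)]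
    linarith
  have h1 : (1 + 1 / ((k : ℝ) + 1)) ^ k ≤ Real.exp 1 := by
    calc (1 + 1 / ((k : ℝ) + 1)) ^ k ≤ Real.exp (1 / ((k : ℝ) + 1)) ^ k := by
          gcongr
          linarith [Real.add_one_le_exp (1 / ((k : ℝ) + 1))]
      _ = Real.exp (k * (1 / ((k : ℝ) + 1))) := (Real.exp_nat_mul _ _).symm
      _ ≤ Real.exp 1 := by
          gcongr
          rw [mul_one_div, div_le_one (by linarith)]
          linarith
  calc (1 : ℝ) = (1 + 1 / ((k : ℝ) + 1)) ^ k * (1 - 1 / ((k : ℝ) + 2)) ^ k := by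
        rw [← mul_pow]
        have : (1 + 1 / ((k : ℝ) + 1)) * (1 - 1 / ((k : ℝ) + 2)) = 1 := by
          field_simp
          ring
        rw [this, one_pow]
    _ ≤ _ := by gcongr

/-- **Abstract Clarkson–Shor type sampling bound** (combinatorial core of Theorem 1).
Each element `z` of `Z` is defined by two distinguished distinct elements `a z, b z` of
`F` and covered by the set `D z ⊆ F` of at most `ω − 2` further elements.  If for every
subfamily `F' ⊆ F` the number of `z ∈ Z` with both defining elements in `F'` and no
covering element in `F'` is at most `c·|F'|`, then `|Z| ≤ c·e·ω·n`. -/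
theorem stmt_7 {α β : Type*} (F : Finset α) (ω : ℕ) (hω : 2 ≤ ω) (c : ℝ) (hc : 0 < c)
    (Z : Finset β) (a b : β → α) (D : β → Finset α)
    (ha : ∀ z ∈ Z, a z ∈ F) (hb : ∀ z ∈ Z, b z ∈ F) (hDF : ∀ z ∈ Z, D z ⊆ F)
    (hab : ∀ z ∈ Z, a z ≠ b z)
    (haD : ∀ z ∈ Z, a z ∉ D z) (hbD : ∀ z ∈ Z, b z ∉ D z)
    (hDcard : ∀ z ∈ Z, (D z).card ≤ ω - 2)
    (hsample : ∀ F' ⊆ F,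
      (({z ∈ Z | a z ∈ F' ∧ b z ∈ F' ∧ D z ∩ F' = ∅}).card : ℝ) ≤ c * F'.card) :
    (Z.card : ℝ) ≤ c * Real.exp 1 * ω * F.card := by
  obtain ⟨k, rfl⟩ := Nat.exists_eq_add_of_le' hω
  have hk : (0 : ℝ) ≤ k := k.cast_nonneg
  set p : ℝ := 1 / ((k : ℝ) + 2) with hp
  have hp0 : 0 < p := by positivity
  have hp1 : 0 ≤ 1 - p := by
    rw [hp, sub_nonneg, div_le_one (by linarith)]
    linarith
  have hlower : ∀ z ∈ Z, p ^ 2 * (1 - p) ^ k ≤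
      ∑ S ∈ F.powerset, (if a z ∈ S ∧ b z ∈ S ∧ D z ∩ S = ∅ then
        p ^ S.card * (1 - p) ^ (F \ S).card else 0) := by
    intro z hz
    have h := sum_powerset_subset_disjoint F {a z, b z} (D z)
      (by simp [Finset.insert_subset_iff, ha z hz, hb z hz]) (hDF z hz)
      (by simp [haD z hz, hbD z hz]) p
    simp only [Finset.insert_subset_iff, Finset.singleton_subset_iff, and_assoc,
      Finset.disjoint_iff_inter_eq_empty, Finset.card_pair (hab z hz)] at h
    rw [h]
    exact mul_le_mul_of_nonneg_left
      (pow_le_pow_of_le_one hp1 (by linarith) (by simpa using hDcard z hz)) (by positivity)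
  have hcount : Z.card * (p ^ 2 * (1 - p) ^ k) ≤ c * (F.card * p) := by
    calc _ = ∑ z ∈ Z, p ^ 2 * (1 - p) ^ k := by simp
      _ ≤ _ := Finset.sum_le_sum hlower
      _ = ∑ S ∈ F.powerset, p ^ S.card * (1 - p) ^ (F \ S).card *
          ({z ∈ Z | a z ∈ S ∧ b z ∈ S ∧ D z ∩ S = ∅}).card := by
          rw [Finset.sum_comm]
          refine Finset.sum_congr rfl fun S _ ↦ ?_
          rw [← Finset.sum_filter, Finset.sum_const, nsmul_eq_mul, mul_comm]
      _ ≤ ∑ S ∈ F.powerset, p ^ S.card * (1 - p) ^ (F \ S).card * (c * S.card) :=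
          Finset.sum_le_sum fun S hS ↦ mul_le_mul_of_nonneg_left
            (hsample S (Finset.mem_powerset.mp hS)) (by positivity)
      _ = c * (F.card * p) := by
          rw [← sum_powerset_weight_mul_card, Finset.mul_sum]
          exact Finset.sum_congr rfl fun S _ ↦ by ring
  have hcancel : Z.card * (1 - p) ^ k * p ≤ c * F.card := by
    refine le_of_mul_le_mul_right ?_ hp0
    linarith
  have hpk : p * ((k : ℝ) + 2) = 1 := by
    rw [hp]
    field_simp
  calc (Z.card : ℝ) ≤ Z.card * (Real.exp 1 * (1 - p) ^ k) :=
        le_mul_of_one_le_right (by positivity) (one_le_exp_one_mul_one_sub_inv_pow k)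
    _ = Z.card * (1 - p) ^ k * p * (Real.exp 1 * ((k : ℝ) + 2)) := by
        linear_combination (-(Z.card : ℝ) * (1 - p) ^ k * Real.exp 1) * hpk
    _ ≤ c * F.card * (Real.exp 1 * ((k : ℝ) + 2)) := by gcongr
    _ = c * Real.exp 1 * (k + 2 : ℕ) * F.card := by
        push_cast
        ring
end
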